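/- arXiv:2508.20819 — 2 statements merged into one kernel-verified Lean document; each statement's English description precedes it below -/
import Mathlib

section
/- For each integer q ≥ 4, there exist a real number c > 1 and a finite simple graph G with minimum degree at least (1 - 1/(c·(q+1)))·v(G) that admits no fractional K_q-decomposition. -/
open scoped Classical

/-- A fractional `K_q`-decomposition of `G`: an assignment of non-negative real weights to the
copies of `K_q` (i.e. the `q`-cliques) of `G` such that for every edge of `G`, the total weight
of the `q`-cliques containing that edge is exactly `1`. -/
def SimpleGraph.HasFractionalDecomposition {V : Type*} [Fintype V] (G : SimpleGraph V)
    (q : ℕ) : Prop :=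
  ∃ w : Finset V → ℝ, (∀ s, 0 ≤ w s) ∧
    ∀ ⦃u v : V⦄, G.Adj u v →
      ∑ s ∈ Finset.univ.filter (fun s : Finset V => G.IsNClique q s ∧ u ∈ s ∧ v ∈ s), w s = 1

namespace SimpleGraph

variable {V : Type*} [Fintype V]

/-- The easy direction of linear programming duality for fractional clique decompositions. -/
theorem HasFractionalDecomposition.sum_nonneg {G : SimpleGraph V} {q : ℕ}
    (h : G.HasFractionalDecomposition q) (y : V → V → ℝ)
    (hy : ∀ s, G.IsNClique q s → 0 ≤ ∑ u ∈ s, ∑ v ∈ s, if G.Adj u v then y u v else 0) :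
    0 ≤ ∑ u, ∑ v, if G.Adj u v then y u v else 0 := by
  obtain ⟨w, hw, hw1⟩ := h
  have key : ∑ u, ∑ v, (if G.Adj u v then y u v else 0) =
      ∑ s : Finset V, if G.IsNClique q s then
        w s * ∑ u ∈ s, ∑ v ∈ s, (if G.Adj u v then y u v else 0) else 0 := by
    calc ∑ u, ∑ v, (if G.Adj u v then y u v else 0)
        = ∑ u, ∑ v, ∑ s : Finset V, (if G.IsNClique q s ∧ u ∈ s ∧ v ∈ s then
            w s * (if G.Adj u v then y u v else 0) else 0) := by
          refine Finset.sum_congr rfl fun u _ => Finset.sum_congr rfl fun v _ => ?_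
          rw [← Finset.sum_filter, ← Finset.sum_mul]
          split_ifs with huv
          · rw [hw1 huv, one_mul]
          · rw [mul_zero]
      _ = ∑ s : Finset V, ∑ u, ∑ v, (if G.IsNClique q s ∧ u ∈ s ∧ v ∈ s then
            w s * (if G.Adj u v then y u v else 0) else 0) := by
          rw [Finset.sum_comm (s := (Finset.univ : Finset (Finset V)))]
          exact Finset.sum_congr rfl fun u _ => Finset.sum_comm
      _ = _ := by
          refine Finset.sum_congr rfl fun s _ => ?_
          by_cases hs : G.IsNClique q s
          · simp only [hs, true_and, if_true, ite_and, Finset.mul_sum]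
            simp [Finset.sum_ite_mem, ← Finset.sum_filter]
          · simp [hs]
  rw [key]
  refine Finset.sum_nonneg fun s _ => ?_
  split_ifs with hs
  · exact mul_nonneg (hw s) (hy s hs)
  · exact le_rfl

/-- The quadratic form `(k - 1) * (k - 2)`, where `k` is the number of vertices of a clique with
`χ v = 1`, is nonnegative on integers, and is a sum of weights of the edges of the clique. -/
theorem HasFractionalDecomposition.sum_indicator_nonneg {G : SimpleGraph V} {q : ℕ}
    (h : G.HasFractionalDecomposition q) (χ : V → ℝ) (hχ : ∀ v, χ v = 0 ∨ χ v = 1) :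
    0 ≤ ∑ u, ∑ v, if G.Adj u v then
      2 - q * (χ u + χ v) + q * (q - 1) * (χ u * χ v) else 0 := by
  refine h.sum_nonneg (fun u v => 2 - q * (χ u + χ v) + q * (q - 1) * (χ u * χ v)) fun s hs => ?_
  have hcard : (s.card : ℝ) = q := by rw [hs.card_eq]
  obtain ⟨k, hk⟩ : ∃ k : ℤ, ∑ v ∈ s, χ v = k := by
    have hz : ∀ v, ∃ z : ℤ, χ v = z := fun v =>
      (hχ v).elim (fun h => ⟨0, by simp [h]⟩) (fun h => ⟨1, by simp [h]⟩)
    choose z hz using hz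
    exact ⟨∑ v ∈ s, z v, by simp [hz]⟩
  have hsq : ∀ v, χ v * χ v = χ v := fun v => by rcases hχ v with h | h <;> simp [h]
  have hrow : ∀ u ∈ s, ∑ v ∈ s, (if G.Adj u v then
      2 - q * (χ u + χ v) + q * (q - 1) * (χ u * χ v) else 0) =
      (2 * (q - 1) - q * k) + (q * (q - 1) * k - q * (q - 1)) * χ u + (2 * q - q * q) * χ u := by
    intro u hu
    have hadj : ∀ v ∈ s, (if G.Adj u v then
        2 - q * (χ u + χ v) + q * (q - 1) * (χ u * χ v) else 0) =
        2 - q * (χ u + χ v) + q * (q - 1) * (χ u * χ v) -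
          if v = u then 2 - q * (χ u + χ u) + q * (q - 1) * (χ u * χ u) else 0 := by
      intro v hv
      by_cases huv : v = u
      · simp [huv]
      · rw [if_pos (hs.isClique hu hv (Ne.symm huv)), if_neg huv, sub_zero]
    rw [Finset.sum_congr rfl hadj, Finset.sum_sub_distrib, Finset.sum_ite_eq' s u, if_pos hu, hsq]
    simp only [Finset.sum_add_distrib, Finset.sum_sub_distrib, ← Finset.mul_sum, hk,
      Finset.sum_const, nsmul_eq_mul, hcard]
    ring
  rw [Finset.sum_congr rfl hrow]
  simp only [Finset.sum_add_distrib, ← Finset.mul_sum, hk, Finset.sum_const, nsmul_eq_mul, hcard]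
  have hint : (0 : ℝ) ≤ (k - 1) * (k - 2) := by
    have : (0 : ℤ) ≤ (k - 1) * (k - 2) := by
      rcases le_or_gt k 1 with h | h
      · exact mul_nonneg_of_nonpos_of_nonpos (by lia) (by lia)
      · exact mul_nonneg (by lia) (by lia)
    exact_mod_cast this
  have hq : (0 : ℝ) ≤ q * (q - 1) := by
    rcases Nat.eq_zero_or_pos q with h0 | h0
    · simp [h0]
    · exact mul_nonneg (by positivity) (by simpa using (by exact_mod_cast h0 : (1 : ℝ) ≤ q))
  nlinarith [mul_nonneg hq hint]

theorem HasFractionalDecomposition.of_iso {W : Type*} [Fintype W] {G : SimpleGraph V}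
    {H : SimpleGraph W} {q : ℕ} (f : G ≃g H) (h : H.HasFractionalDecomposition q) :
    G.HasFractionalDecomposition q := by
  obtain ⟨w, hw, hw1⟩ := h
  refine ⟨fun s => w (s.map f.toEquiv.toEmbedding), fun s => hw _, fun u v huv => ?_⟩
  rw [← hw1 (f.map_adj_iff.2 huv)]
  refine Finset.sum_equiv f.toEquiv.finsetCongr (fun s => ?_) fun s _ => rfl
  have hclique : H.IsNClique q (s.map f.toEquiv.toEmbedding) ↔ G.IsNClique q s := by
    simp only [isNClique_iff, Finset.card_map, isClique_iff, Finset.coe_map]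
    refine and_congr_left fun _ => ?_
    rw [show (f.toEquiv.toEmbedding : V → W) = f from rfl, f.injective.injOn.pairwise_image]
    simp only [Set.Pairwise, Function.onFun, f.map_adj_iff]
  have hmem (x : V) : f x ∈ s.map f.toEquiv.toEmbedding ↔ x ∈ s :=
    Finset.mem_map' f.toEquiv.toEmbedding
  simp only [Finset.mem_filter, Finset.mem_univ, true_and, Equiv.finsetCongr_apply, hclique, hmem]

/-- The vertices of `sparseJoin r`: a bipartite piece, `r` large independent sets and one small
independent set. -/
abbrev SparseJoinVertex (r : ℕ) : Type :=
  (Fin 2 × Fin 22 × Fin 2) ⊕ ((Fin r × Fin 46) ⊕ Fin 5)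

/-- The join of the blow-up of `K_{22,22}` minus a perfect matching, by independent pairs, with a
complete multipartite graph having `r` classes of size `46` and one class of size `5`. -/
def sparseJoin (r : ℕ) : SimpleGraph (SparseJoinVertex r) where
  Adj
    | .inl a, .inl b => a.1 ≠ b.1 ∧ a.2.1 ≠ b.2.1
    | .inr (.inl a), .inr (.inl b) => a.1 ≠ b.1
    | .inr (.inr _), .inr (.inr _) => False
    | _, _ => True
  symm := ⟨by
    rintro (a | a | a) (b | b | b) h <;> simp_all [eq_comm]⟩
  loopless := ⟨by
    rintro (a | a | a) h <;> simp_all⟩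

/-- Summation over the neighbourhood of a vertex of `sparseJoin r` of a function which only
depends on whether the neighbour lies in the bipartite piece. -/
theorem sum_sparseJoin (r : ℕ) (u : SparseJoinVertex r) (x y : ℝ) :
    ∑ v, (if (sparseJoin r).Adj u v then Sum.elim (fun _ => x) (fun _ => y) v else 0) =
      match u with
      | .inl _ => 42 * x + (46 * r + 5) * y
      | .inr (.inl _) => 88 * x + (46 * r - 41) * y
      | .inr (.inr _) => 88 * x + 46 * r * y := by
  rcases u with ⟨i, j, k⟩ | ⟨i, j⟩ | i
  · have hA : ∑ b, (if (sparseJoin r).Adj (.inl (i, j, k)) (.inl b) then x else 0) = 42 * x := by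
      have : (Finset.univ.filter fun b => (sparseJoin r).Adj (.inl (i, j, k)) (.inl b)) =
          ({i}ᶜ : Finset (Fin 2)) ×ˢ (({j}ᶜ : Finset (Fin 22)) ×ˢ Finset.univ) := by
        ext
        simp only [Finset.mem_filter, Finset.mem_univ, true_and, Finset.mem_product,
          Finset.mem_compl, Finset.mem_singleton, and_true]
        simp [sparseJoin, eq_comm]
      rw [← Finset.sum_filter, this]
      simp [Finset.card_product, Finset.card_compl]
    have hB (b) : (sparseJoin r).Adj (.inl (i, j, k)) (.inr b) := trivial
    simp only [Fintype.sum_sum_type, Sum.elim_inl, Sum.elim_inr, hA, hB, if_true, Fintype.card_sum,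
      Finset.sum_const, Finset.card_univ, Fintype.card_prod, Fintype.card_fin, nsmul_eq_mul]
    push_cast
    ring
  · have hA (b) : (sparseJoin r).Adj (.inr (.inl (i, j))) (.inl b) := trivial
    have hB : ∑ b, (if (sparseJoin r).Adj (.inr (.inl (i, j))) (.inr (.inl b)) then y else 0) =
        (r - 1) * 46 * y := by
      have : (Finset.univ.filter fun b =>
          (sparseJoin r).Adj (.inr (.inl (i, j))) (.inr (.inl b))) =
          ({i}ᶜ : Finset (Fin r)) ×ˢ Finset.univ := by
        ext
        simp only [Finset.mem_filter, Finset.mem_univ, true_and, Finset.mem_product,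
          Finset.mem_compl, Finset.mem_singleton, and_true]
        simp [sparseJoin, eq_comm]
      rw [← Finset.sum_filter, this, Finset.sum_const, Finset.card_product, Finset.card_compl,
        nsmul_eq_mul]
      simp [Nat.cast_sub (show 1 ≤ r from i.pos)]
    have hC (b) : (sparseJoin r).Adj (.inr (.inl (i, j))) (.inr (.inr b)) := trivial
    simp only [Fintype.sum_sum_type, Sum.elim_inl, Sum.elim_inr, hA, hB, hC, if_true,
      Finset.sum_const, Finset.card_univ, Fintype.card_prod, Fintype.card_fin, nsmul_eq_mul]
    push_cast
    ring
  · have hA (b) : (sparseJoin r).Adj (.inr (.inr i)) (.inl b) := trivial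
    have hB (b) : (sparseJoin r).Adj (.inr (.inr i)) (.inr (.inl b)) := trivial
    have hC (b) : ¬ (sparseJoin r).Adj (.inr (.inr i)) (.inr (.inr b)) := id
    simp only [Fintype.sum_sum_type, Sum.elim_inl, Sum.elim_inr, hA, hB, hC, if_true, if_false,
      Finset.sum_const, Finset.card_univ, Fintype.card_prod, Fintype.card_fin, nsmul_eq_mul]
    push_cast
    ring

theorem le_degree_sparseJoin (r : ℕ) (u : SparseJoinVertex r) :
    46 * r + 47 ≤ (sparseJoin r).degree u := by
  have h := sum_sparseJoin r u 1 1
  have hd : ((sparseJoin r).degree u : ℝ) = ∑ v, (if (sparseJoin r).Adj u v then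
      Sum.elim (fun _ => (1 : ℝ)) (fun _ => 1) v else 0) := by
    rw [← card_neighborFinset_eq_degree, neighborFinset_eq_filter, ← Finset.sum_filter]
    simp
  have : (46 * r + 47 : ℝ) ≤ (sparseJoin r).degree u := by
    rw [hd, h]
    rcases u with u | u | u <;> simp only <;> linarith
  exact_mod_cast this

theorem not_hasFractionalDecomposition_sparseJoin (q : ℕ) (hq : 4 ≤ q) :
    ¬ (sparseJoin (q - 1)).HasFractionalDecomposition q := by
  intro h
  have h0 := h.sum_indicator_nonneg (Sum.elim (fun _ => 1) (fun _ => 0))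
    (by rintro (v | v) <;> simp)
  have hq4 : (4 : ℝ) ≤ q := by exact_mod_cast hq
  have hrow (u v : SparseJoinVertex (q - 1)) :
      2 - q * (Sum.elim (fun _ => (1 : ℝ)) (fun _ => 0) u + Sum.elim (fun _ => 1) (fun _ => 0) v) +
        q * (q - 1) * (Sum.elim (fun _ => 1) (fun _ => 0) u * Sum.elim (fun _ => 1) (fun _ => 0) v) =
      Sum.elim (fun _ => Sum.elim (fun _ => (q - 1) * (q - 2) : _ → ℝ) (fun _ => 2 - q) u)
        (fun _ => Sum.elim (fun _ => 2 - q) (fun _ => 2) u) v := by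
    rcases u with u | u <;> rcases v with v | v
    · simp
      ring
    all_goals simp
  simp only [hrow, sum_sparseJoin] at h0
  simp only [Fintype.sum_sum_type, Sum.elim_inl, Sum.elim_inr, Finset.sum_const, Finset.card_univ,
    Fintype.card_prod, Fintype.card_fin, nsmul_eq_mul] at h0
  push_cast [Nat.cast_sub (by lia : 1 ≤ q)] at h0
  nlinarith

end SimpleGraph

/-- For each integer `q ≥ 4`, there exist a real `c > 1` and a finite simple graph `G` with
minimum degree at least `(1 - 1/(c·(q+1)))·v(G)` admitting no fractional
`K_q`-decomposition. -/
theorem statement6 (q : ℕ) (hq : 4 ≤ q) :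
    ∃ (c : ℝ) (n : ℕ) (G : SimpleGraph (Fin n)), 1 < c ∧
      (1 - 1 / (c * (q + 1))) * n ≤ (G.minDegree : ℝ) ∧
      ¬ G.HasFractionalDecomposition q := by
  have hc : (0 : ℝ) < 46 * (q + 1) := by positivity
  have hn : Fintype.card (SimpleGraph.SparseJoinVertex (q - 1)) = 46 * (q + 1) + 1 := by
    simp
    lia
  have f := (SimpleGraph.sparseJoin (q - 1)).overFinIso hn
  refine ⟨(46 * (q + 1) + 1) / (46 * (q + 1)), _, _, ?_, ?_, fun h =>
    SimpleGraph.not_hasFractionalDecomposition_sparseJoin q hq (h.of_iso f)⟩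
  · rw [lt_div_iff₀ hc]
    linarith
  · have : Nonempty (Fin (46 * (q + 1) + 1)) := ⟨0⟩
    have hdeg : 46 * q + 1 ≤ ((SimpleGraph.sparseJoin (q - 1)).overFin hn).minDegree := by
      refine SimpleGraph.le_minDegree_of_forall_le_degree _ _ fun v => ?_
      have := SimpleGraph.le_degree_sparseJoin (q - 1) (f.symm v)
      rw [f.symm.degree_eq] at this
      lia
    have hdeg' : (46 * q + 1 : ℝ) ≤
        ((SimpleGraph.sparseJoin (q - 1)).overFin hn).minDegree := by exact_mod_cast hdeg
    refine le_trans (le_of_eq ?_) hdeg'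
    push_cast
    field_simp
    ring
end

section
/- There exist a real number c > 1 and a finite simple graph G with minimum degree at least (1 - 1/(c·5))·v(G) such that G admits no fractional K_4-decomposition. -/
open scoped Classical

/-- Farkas-type obstruction: an edge weighting that is non-negative on every `q`-clique but has
negative total weight excludes a fractional `K_q`-decomposition. -/
theorem SimpleGraph.not_hasFractionalDecomposition_of_weight {V : Type*} [Fintype V]
    (G : SimpleGraph V) (q : ℕ) (f : V → V → ℤ)
    (hclique : ∀ s : Finset V, G.IsNClique q s →
      0 ≤ ∑ u ∈ s, ∑ v ∈ s, if G.Adj u v then f u v else 0)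
    (htotal : ∑ u, ∑ v, (if G.Adj u v then f u v else 0) < 0) :
    ¬ G.HasFractionalDecomposition q := by
  rintro ⟨w, hw, hsum⟩
  have key : ((∑ u, ∑ v, (if G.Adj u v then f u v else 0) : ℤ) : ℝ) =
      ∑ s : Finset V, if G.IsNClique q s then
        w s * ((∑ u ∈ s, ∑ v ∈ s, if G.Adj u v then f u v else 0 : ℤ) : ℝ) else 0 := by
    calc ((∑ u, ∑ v, (if G.Adj u v then f u v else 0) : ℤ) : ℝ)
        = ∑ u, ∑ v, ∑ s : Finset V, if G.IsNClique q s ∧ u ∈ s ∧ v ∈ s then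
            w s * ((if G.Adj u v then f u v else 0 : ℤ) : ℝ) else 0 := by
          rw [Int.cast_sum]
          refine Finset.sum_congr rfl fun u _ => ?_
          rw [Int.cast_sum]
          refine Finset.sum_congr rfl fun v _ => ?_
          rw [← Finset.sum_filter, ← Finset.sum_mul]
          by_cases h : G.Adj u v
          · rw [hsum h, one_mul]
          · simp [h]
      _ = ∑ s : Finset V, ∑ u, ∑ v, if G.IsNClique q s ∧ u ∈ s ∧ v ∈ s then
            w s * ((if G.Adj u v then f u v else 0 : ℤ) : ℝ) else 0 := by
          rw [Finset.sum_comm (s := (Finset.univ : Finset (Finset V)))]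
          exact Finset.sum_congr rfl fun u _ => Finset.sum_comm
      _ = _ := by
          refine Finset.sum_congr rfl fun s _ => ?_
          by_cases h : G.IsNClique q s
          · simp only [h, true_and, if_true, Int.cast_sum, Finset.mul_sum]
            rw [← Finset.sum_subset (Finset.subset_univ s) (fun u _ hu => by simp [hu])]
            refine Finset.sum_congr rfl fun u hu => ?_
            rw [← Finset.sum_subset (Finset.subset_univ s) (fun v _ hv => by simp [hv])]
            exact Finset.sum_congr rfl fun v hv => by rw [if_pos ⟨hu, hv⟩]
          · simp [h]
  have hnonneg : (0 : ℝ) ≤ ((∑ u, ∑ v, (if G.Adj u v then f u v else 0) : ℤ) : ℝ) := by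
    rw [key]
    refine Finset.sum_nonneg fun s _ => ?_
    split_ifs with h
    · exact mul_nonneg (hw s) (by exact_mod_cast hclique s h)
    · exact le_rfl
  exact absurd htotal (not_lt.mpr (by exact_mod_cast hnonneg))

/-- Adjacency in the join of two circulant graphs, on `{0, …, 41}` and `{42, …, 65}`, in each of
which a vertex is non-adjacent to exactly the vertices at cyclic distance at most `6`. -/
def circulantJoinAdj (u v : ℕ) : Bool :=
  if u < 42 then
    if v < 42 then Nat.blt 6 ((u - v) + (v - u)) && Nat.blt ((u - v) + (v - u)) 36 else true
  else
    if v < 42 then true else Nat.blt 6 ((u - v) + (v - u)) && Nat.blt ((u - v) + (v - u)) 18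

theorem circulantJoinAdj_comm (u v : ℕ) : circulantJoinAdj u v = circulantJoinAdj v u := by
  unfold circulantJoinAdj
  rw [add_comm (u - v)]
  split_ifs <;> rfl

theorem circulantJoinAdj_self (u : ℕ) : circulantJoinAdj u u = false := by
  unfold circulantJoinAdj
  simp [Nat.blt]

def circulantJoin : SimpleGraph (Fin 66) where
  Adj u v := circulantJoinAdj u v = true
  symm := ⟨fun u v h => by rwa [circulantJoinAdj_comm]⟩
  loopless := ⟨fun u h => by simp [circulantJoinAdj_self] at h⟩

/-- Indicator of the second side of the join. -/
def joinSide (u : ℕ) : ℤ := if u < 42 then 0 else 1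

/-- The weight is `1` inside the first side, `3` inside the second side, `-1` across. -/
def joinWeight (u v : ℕ) : ℤ :=
  1 - 2 * joinSide u - 2 * joinSide v + 6 * (joinSide u * joinSide v)

theorem circulantJoin_le_degree (u : Fin 66) : 53 ≤ circulantJoin.degree u := by
  have h : ∀ u : Fin 66,
      53 ≤ (Finset.univ.filter fun v : Fin 66 => circulantJoinAdj u v = true).card := by
    decide +kernel
  rw [← SimpleGraph.card_neighborFinset_eq_degree, SimpleGraph.neighborFinset_eq_filter]
  convert h u
  exact Iff.rfl

theorem circulantJoin_sum_weight_neg :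
    ∑ u : Fin 66, ∑ v : Fin 66, (if circulantJoin.Adj u v then joinWeight u v else 0) < 0 := by
  have h : ∑ u : Fin 66, ∑ v : Fin 66,
      (if circulantJoinAdj u v = true then joinWeight u v else 0) < 0 := by
    decide +kernel
  convert h
  exact Iff.rfl

theorem joinWeight_clique_nonneg (G : SimpleGraph (Fin 66)) (s : Finset (Fin 66))
    (hs : G.IsNClique 4 s) :
    0 ≤ ∑ u ∈ s, ∑ v ∈ s, if G.Adj u v then joinWeight u v else 0 := by
  have hdiag (u : Fin 66) : joinWeight u u = 1 + 2 * joinSide u := by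
    unfold joinWeight joinSide
    split_ifs <;> norm_num
  have hinner (u : Fin 66) (hu : u ∈ s) :
      (∑ v ∈ s, if G.Adj u v then joinWeight u v else 0) =
        ∑ v ∈ s, joinWeight u v - (1 + 2 * joinSide u) := by
    rw [← Finset.sum_erase_add s _ hu, ← Finset.sum_erase_add s (fun v => joinWeight u v) hu,
      hdiag, if_neg (G.loopless.irrefl u), add_zero, add_sub_cancel_right]
    refine Finset.sum_congr rfl fun v hv => ?_
    rw [Finset.mem_erase] at hv
    exact if_pos (hs.isClique hu hv.2 hv.1.symm)
  rw [Finset.sum_congr rfl hinner]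
  have hsum : ∑ u ∈ s, (∑ v ∈ s, joinWeight u v - (1 + 2 * joinSide u)) =
      6 * ((∑ u ∈ s, joinSide u - 1) * (∑ u ∈ s, joinSide u - 2)) := by
    simp only [joinWeight, Finset.sum_add_distrib, Finset.sum_sub_distrib, ← Finset.mul_sum,
      Finset.sum_const, hs.card_eq, ← Finset.sum_mul]
    simp only [nsmul_eq_mul, ← Finset.mul_sum]
    push_cast
    ring
  rw [hsum]
  generalize ∑ u ∈ s, joinSide u = j
  rcases le_or_gt j 1 with h | h <;> nlinarith

/-- There exist a real `c > 1` and a finite simple graph `G` with minimum degree at least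
`(1 - 1/(c·5))·v(G)` admitting no fractional `K_4`-decomposition. -/
theorem statement11 :
    ∃ (c : ℝ) (n : ℕ) (G : SimpleGraph (Fin n)), 1 < c ∧
      (1 - 1 / (c * 5)) * n ≤ (G.minDegree : ℝ) ∧
      ¬ G.HasFractionalDecomposition 4 := by
  refine ⟨66 / 65, 66, circulantJoin, by norm_num, ?_, ?_⟩
  · have h : 53 ≤ circulantJoin.minDegree :=
      circulantJoin.le_minDegree_of_forall_le_degree 53 circulantJoin_le_degree
    have h' : (53 : ℝ) ≤ circulantJoin.minDegree := by exact_mod_cast h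
    refine le_trans (by norm_num) h'
  · exact circulantJoin.not_hasFractionalDecomposition_of_weight 4 (fun u v => joinWeight u v)
      (joinWeight_clique_nonneg circulantJoin) circulantJoin_sum_weight_neg
end
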